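/- Let G be a graph of order n with γ_ri2(G) ≥ 4 and γ_ri2(G) + γ_ri2(Ḡ) = n + 3, where Ḡ is the complement of G, and let f be a 2RiDF of G of minimum weight with colour classes V_0, V_1, V_2 (V_j = f^{-1}(j)). Then for any two distinct vertices u, v ∈ V_0, the set N_Ḡ({u,v}) = (N_Ḡ(u) ∪ N_Ḡ(v)) \ {u,v} of vertices outside {u,v} adjacent in Ḡ to u or v has size at least 3. -/

import Mathlib

open scoped Classical

/-- A `k`-rainbow independent dominating function of `G`: values in `{0,...,k}`,
each nonzero colour class is independent, and every vertex of value `0` has,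
for each `i ∈ {1,...,k}`, a neighbor of value `i`. -/
def IsKRiDF {V : Type*} (G : SimpleGraph V) (k : ℕ) (f : V → ℕ) : Prop :=
  (∀ v, f v ≤ k) ∧
  (∀ i, 1 ≤ i → i ≤ k → ∀ u v, f u = i → f v = i → ¬ G.Adj u v) ∧
  (∀ v, f v = 0 → ∀ i, 1 ≤ i → i ≤ k → ∃ u, G.Adj v u ∧ f u = i)

/-- The weight of a labelling: the number of vertices with nonzero value. -/
noncomputable def riWeight {V : Type*} [Fintype V] (f : V → ℕ) : ℕ :=
  (Finset.univ.filter fun v => f v ≠ 0).card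

/-- The `k`-rainbow independent domination number. -/
noncomputable def riNumber {V : Type*} [Fintype V] (G : SimpleGraph V) (k : ℕ) : ℕ :=
  sInf {w | ∃ f, IsKRiDF G k f ∧ riWeight f = w}

/-- The star `S_m = K_{1,m}` on `Fin (m+1)` with centre `0`. -/
def starGraph (m : ℕ) : SimpleGraph (Fin (m + 1)) :=
  SimpleGraph.fromRel (fun a b => (a : ℕ) = 0 ∧ (b : ℕ) ≠ 0)

/-- The star `S_m` with one extra edge between the leaves `1` and `2`. -/
def starPlusGraph (m : ℕ) : SimpleGraph (Fin (m + 1)) :=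
  SimpleGraph.fromRel (fun a b => ((a : ℕ) = 0 ∧ (b : ℕ) ≠ 0) ∨ ((a : ℕ) = 1 ∧ (b : ℕ) = 2))

/-- The double star `S(n,m)`: centres `0` (with leaves `2,...,n+1`) and `1`
(with leaves `n+2,...,n+m+1`), joined by the bridge `01`. -/
def doubleStar (n m : ℕ) : SimpleGraph (Fin (n + m + 2)) :=
  SimpleGraph.fromRel (fun a b =>
    ((a : ℕ) = 0 ∧ (b : ℕ) = 1) ∨
    ((a : ℕ) = 0 ∧ 2 ≤ (b : ℕ) ∧ (b : ℕ) < n + 2) ∨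
    ((a : ℕ) = 1 ∧ n + 2 ≤ (b : ℕ)))

theorem riNumber_le_riWeight {V : Type*} [Fintype V] {G : SimpleGraph V} {k : ℕ} {f : V → ℕ}
    (hf : IsKRiDF G k f) : riNumber G k ≤ riWeight f :=
  Nat.sInf_le ⟨f, hf, rfl⟩

theorem riWeight_le_card {V : Type*} [Fintype V] {f : V → ℕ} {S : Finset V}
    (h : ∀ v, f v ≠ 0 → v ∈ S) : riWeight f ≤ S.card :=
  Finset.card_le_card fun v hv => h v (Finset.mem_filter.1 hv).2

/-- An independent set disjoint from `B` extends to one that dominates everything outside `B`. -/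
theorem exists_independent_dominating_superset {V : Type*} [Fintype V] (G : SimpleGraph V)
    (A B : Finset V) (hA : ∀ x ∈ A, ∀ y ∈ A, ¬ G.Adj x y) (hAB : Disjoint A B) :
    ∃ A' : Finset V, A ⊆ A' ∧ (∀ x ∈ A', ∀ y ∈ A', ¬ G.Adj x y) ∧ Disjoint A' B ∧
      ∀ v, v ∉ A' → v ∉ B → ∃ u ∈ A', G.Adj v u := by
  obtain ⟨A', hle, hmax⟩ := (Set.toFinite
    {S : Finset V | (∀ x ∈ S, ∀ y ∈ S, ¬ G.Adj x y) ∧ Disjoint S B}).exists_le_maximal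
      (show A ∈ _ from ⟨hA, hAB⟩)
  obtain ⟨hind, hdisj⟩ := hmax.prop
  refine ⟨A', hle, hind, hdisj, fun v hv hvB => ?_⟩
  by_contra! hno
  have hmem : insert v A' ∈
      {S : Finset V | (∀ x ∈ S, ∀ y ∈ S, ¬ G.Adj x y) ∧ Disjoint S B} := by
    refine ⟨?_, by simpa [Finset.disjoint_insert_left] using ⟨hvB, hdisj⟩⟩
    intro x hx y hy hxy
    rw [Finset.mem_insert] at hx hy
    rcases hx with rfl | hx <;> rcases hy with rfl | hy
    · exact G.loopless.irrefl _ hxy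
    · exact hno y hy hxy
    · exact hno x hx hxy.symm
    · exact hind x hx y hy hxy
  exact hv (hmax.le_of_ge hmem (Finset.subset_insert v A') (Finset.mem_insert_self v A'))

theorem exists_isKRiDF_two_extending {V : Type*} [Fintype V] (G : SimpleGraph V)
    (A B : Finset V) (hA : ∀ x ∈ A, ∀ y ∈ A, ¬ G.Adj x y) (hB : ∀ x ∈ B, ∀ y ∈ B, ¬ G.Adj x y)
    (hAB : Disjoint A B) :
    ∃ f : V → ℕ, IsKRiDF G 2 f ∧ (∀ v ∈ A, f v = 1) ∧ ∀ v ∈ B, f v = 2 := by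
  obtain ⟨A', hAA', hA', hA'B, hdA⟩ := exists_independent_dominating_superset G A B hA hAB
  obtain ⟨B', hBB', hB', hBA', hdB⟩ :=
    exists_independent_dominating_superset G B A' hB hA'B.symm
  have hdis : ∀ v, v ∈ B' → v ∉ A' := fun v hv => Finset.disjoint_left.1 hBA' hv
  have h1 : ∀ v, (if v ∈ A' then 1 else if v ∈ B' then 2 else 0) = 1 ↔ v ∈ A' := by
    intro v; split_ifs <;> simp_all
  have h2 : ∀ v, (if v ∈ A' then 1 else if v ∈ B' then 2 else 0) = 2 ↔ v ∈ B' := by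
    intro v
    split_ifs with hA hB
    · simpa using fun hB => hdis v hB hA
    · simpa using hB
    · simpa using hB
  refine ⟨fun v => if v ∈ A' then 1 else if v ∈ B' then 2 else 0, ⟨?_, ?_, ?_⟩,
    fun v hv => (h1 v).2 (hAA' hv), fun v hv => (h2 v).2 (hBB' hv)⟩
  · intro v
    dsimp only
    split_ifs <;> simp
  · intro i hi hi2 u v hu hv
    obtain rfl | rfl : i = 1 ∨ i = 2 := by omega
    · exact hA' u ((h1 u).1 hu) v ((h1 v).1 hv)
    · exact hB' u ((h2 u).1 hu) v ((h2 v).1 hv)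
  · intro v hv i hi hi2
    have hvA : v ∉ A' := fun h => by simp [h] at hv
    have hvB : v ∉ B' := fun h => by simp [h, hvA] at hv
    obtain rfl | rfl : i = 1 ∨ i = 2 := by omega
    · obtain ⟨u, hu, huv⟩ := hdA v hvA fun h => hvB (hBB' h)
      exact ⟨u, huv, (h1 u).2 hu⟩
    · obtain ⟨u, hu, huv⟩ := hdB v hvB hvA
      exact ⟨u, huv, (h2 u).2 hu⟩

/-- If every 2RiDF of `H` has at most one vertex of value `0`, then two vertices dominated by a
common pair of colour classes coincide. -/
theorem eq_of_dominated_of_card_le_riNumber {V : Type*} [Fintype V] {H : SimpleGraph V}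
    (hH : Fintype.card V ≤ riNumber H 2 + 1) {p₁ p₂ q₁ q₂ x y : V} (h11 : p₁ ≠ q₁)
    (h12 : p₁ ≠ q₂) (h21 : p₂ ≠ q₁) (h22 : p₂ ≠ q₂) (hp : ¬ H.Adj p₁ p₂) (hq : ¬ H.Adj q₁ q₂)
    (hx1 : H.Adj x p₁) (hx2 : H.Adj x q₁) (hy1 : H.Adj y p₂) (hy2 : H.Adj y q₂) : x = y := by
  obtain ⟨g, hg, hg1, hg2⟩ := exists_isKRiDF_two_extending H {p₁, p₂} {q₁, q₂}
    (by simp [hp, H.adj_comm p₂ p₁]) (by simp [hq, H.adj_comm q₂ q₁]) (by simp [*, Ne.symm])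
  have hzero : ∀ z p q, g p = 1 → g q = 2 → H.Adj z p → H.Adj z q → g z = 0 := by
    intro z p q h1 h2 hzp hzq
    have hle := hg.1 z
    by_contra h0
    obtain h | h : g z = 1 ∨ g z = 2 := by omega
    · exact hg.2.1 1 le_rfl (by norm_num) z p h h1 hzp
    · exact hg.2.1 2 (by norm_num) le_rfl z q h h2 hzq
  have hx := hzero x p₁ q₁ (hg1 _ (by simp)) (hg2 _ (by simp)) hx1 hx2
  have hy := hzero y p₂ q₂ (hg1 _ (by simp)) (hg2 _ (by simp)) hy1 hy2
  by_contra hxy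
  have hw : riWeight g ≤ (({x, y} : Finset V)ᶜ).card := by
    refine riWeight_le_card fun v hv => ?_
    simp only [Finset.mem_compl, Finset.mem_insert, Finset.mem_singleton]
    rintro (rfl | rfl) <;> contradiction
  have hc := Finset.card_add_card_compl ({x, y} : Finset V)
  rw [Finset.card_pair hxy] at hc
  have := riNumber_le_riWeight hg
  omega

/-- A complement clique `{x, y}` and a vertex `z`, both nonextendable outside `{x, y, z}`,
give a 2RiDF of weight at most three. -/
theorem riNumber_two_le_three_of_compl {V : Type*} [Fintype V] {G : SimpleGraph V} {x y z : V}
    (hzx : z ≠ x) (hzy : z ≠ y) (hxy : x = y ∨ Gᶜ.Adj x y)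
    (h : ∀ t, t ≠ x → t ≠ y → t ≠ z →
      ¬ Gᶜ.Adj t z ∧ (¬ Gᶜ.Adj t x ∨ ¬ Gᶜ.Adj t y)) :
    riNumber G 2 ≤ 3 := by
  have hG : ∀ a b, a ≠ b → ¬ Gᶜ.Adj a b → G.Adj a b := by
    intro a b hab hn
    by_contra hc
    exact hn ((SimpleGraph.compl_adj G a b).2 ⟨hab, hc⟩)
  have hxy' : ¬ G.Adj x y := by
    rcases hxy with rfl | hxy
    · exact G.loopless.irrefl x
    · exact ((SimpleGraph.compl_adj G x y).1 hxy).2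
  have hf : IsKRiDF G 2 (fun t => if t = x ∨ t = y then 1 else if t = z then 2 else 0) := by
    refine ⟨fun t => ?_, fun i hi hi2 a b ha hb => ?_, fun t ht i hi hi2 => ?_⟩
    · dsimp only
      split_ifs <;> simp
    · have hsym : ¬ G.Adj y x := fun h => hxy' h.symm
      dsimp only at ha hb
      split_ifs at ha hb with h1 h2 h3 h4 <;> try omega
      · rcases h1 with rfl | rfl <;> rcases h2 with rfl | rfl <;>
          first | assumption | exact G.loopless.irrefl _
      · subst_vars
        exact G.loopless.irrefl _
    · have htx : t ≠ x := fun h => by simp [h] at ht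
      have hty : t ≠ y := fun h => by simp [h] at ht
      have htz : t ≠ z := fun h => by simp [h, hzx, hzy] at ht
      obtain ⟨hz, hc⟩ := h t htx hty htz
      obtain rfl | rfl : i = 1 ∨ i = 2 := by omega
      · rcases hc with hc | hc
        · exact ⟨x, hG t x htx hc, by simp⟩
        · exact ⟨y, hG t y hty hc, by simp⟩
      · exact ⟨z, hG t z htz hz, by simp [hzx, hzy]⟩
  refine (riNumber_le_riWeight hf).trans ((riWeight_le_card (S := {x, y, z}) ?_).trans
    Finset.card_le_three)
  intro t ht
  by_contra hc
  simp only [Finset.mem_insert, Finset.mem_singleton, not_or] at hc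
  simp [hc] at ht

theorem riNumber_two_le_of_compl_neighbors {V : Type*} [Fintype V] (G : SimpleGraph V) {u v : V}
    (huv : u ≠ v) :
    riNumber G 2 ≤ ((Gᶜ.neighborFinset u ∪ Gᶜ.neighborFinset v) \ {u, v}).card + 2 := by
  obtain ⟨g, hg, hgu, hgv⟩ := exists_isKRiDF_two_extending G {u} {v} (by simp) (by simp)
    (by simpa using huv)
  replace hgu := hgu u (by simp)
  replace hgv := hgv v (by simp)
  refine (riNumber_le_riWeight hg).trans ((riWeight_le_card
    (S := (Gᶜ.neighborFinset u ∪ Gᶜ.neighborFinset v) \ {u, v} ∪ {u, v}) ?_).trans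
    ((Finset.card_union_le _ _).trans (Nat.add_le_add_left Finset.card_le_two _)))
  intro t ht
  by_cases htu : t = u
  · simp [htu]
  by_cases htv : t = v
  · simp [htv]
  have hle := hg.1 t
  obtain h | h : g t = 1 ∨ g t = 2 := by omega
  · have := hg.2.1 1 le_rfl (by norm_num) u t hgu h
    simp [htu, htv, this, Ne.symm htu]
  · have := hg.2.1 2 (by norm_num) le_rfl v t hgv h
    simp [htu, htv, this, Ne.symm htv]

section NoSmallPair

variable {V : Type*} [Fintype V] {G : SimpleGraph V}

theorem eq_of_compl_common_neighbors (hH : Fintype.card V ≤ riNumber Gᶜ 2 + 1) {p q x y : V}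
    (hpq : p ≠ q) (hx1 : Gᶜ.Adj x p) (hx2 : Gᶜ.Adj x q) (hy1 : Gᶜ.Adj y p)
    (hy2 : Gᶜ.Adj y q) : x = y :=
  eq_of_dominated_of_card_le_riNumber hH hpq hpq hpq hpq (Gᶜ.loopless.irrefl p)
    (Gᶜ.loopless.irrefl q) hx1 hx2 hy1 hy2

/-- In the complement, each vertex of a triangle has a neighbor outside the triangle. -/
theorem exists_compl_adj_of_triangle (h4 : 4 ≤ riNumber G 2)
    (hH : Fintype.card V ≤ riNumber Gᶜ 2 + 1) {x y z : V} (hxy : Gᶜ.Adj x y)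
    (hxz : Gᶜ.Adj x z) (hyz : Gᶜ.Adj y z) : ∃ t, t ≠ x ∧ t ≠ y ∧ Gᶜ.Adj t z := by
  by_contra! hno
  have := riNumber_two_le_three_of_compl hxz.ne' hyz.ne' (.inr hxy) fun t htx hty htz =>
    ⟨hno t htx hty, not_and_or.1 fun ⟨h1, h2⟩ =>
      htz (eq_of_compl_common_neighbors hH hxy.ne h1 h2 hxz.symm hyz.symm)⟩
  omega

/-- The complement has no vertex of degree one. -/
theorem exists_compl_adj_ne (h4 : 4 ≤ riNumber G 2)
    (hH : Fintype.card V ≤ riNumber Gᶜ 2 + 1) {z x : V} (hzx : Gᶜ.Adj z x) :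
    ∃ t, t ≠ x ∧ Gᶜ.Adj z t := by
  by_contra! hleaf
  obtain ⟨y, hyz, hxy⟩ : ∃ y, y ≠ z ∧ Gᶜ.Adj x y := by
    by_contra! hno
    have := riNumber_two_le_three_of_compl hzx.ne hzx.ne (.inl rfl) fun t htx _ htz =>
      ⟨fun h => hleaf t htx h.symm, .inl fun h => hno t htz h.symm⟩
    omega
  by_cases htri : ∃ t, Gᶜ.Adj t x ∧ Gᶜ.Adj t y
  · obtain ⟨t, htx, hty⟩ := htri
    obtain ⟨s, hsx, hst, hsy⟩ := exists_compl_adj_of_triangle h4 hH htx.symm hxy hty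
    refine hxy.ne (eq_of_dominated_of_card_le_riNumber hH (p₁ := z) (p₂ := s) (q₁ := t)
      (q₂ := t) ?_ ?_ hst hst (hleaf s hsx) (Gᶜ.loopless.irrefl t) hzx.symm htx.symm hsy.symm
      hty.symm) <;>
    · rintro rfl
      exact hleaf y hxy.ne' hty
  · push Not at htri
    have := riNumber_two_le_three_of_compl hzx.ne hyz.symm (.inr hxy) fun t htx _ htz =>
      ⟨fun h => hleaf t htx h.symm, not_and_or.1 fun ⟨h1, h2⟩ => htri t h1 h2⟩
    omega

/-- For a complement path `a, v, u, b` with `u` and `v` of degree two, a further neighbor of `b`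
is adjacent to `a`. -/
theorem compl_adj_of_path (h4 : 4 ≤ riNumber G 2)
    (hH : Fintype.card V ≤ riNumber Gᶜ 2 + 1) {u v a b t : V}
    (hu : ∀ t, Gᶜ.Adj u t → t = v ∨ t = b) (hv : ∀ t, Gᶜ.Adj v t → t = u ∨ t = a)
    (huv : Gᶜ.Adj u v) (hub : Gᶜ.Adj u b) (hbv : b ≠ v) (htu : t ≠ u) (htv : t ≠ v)
    (htb : Gᶜ.Adj t b) : Gᶜ.Adj t a := by
  obtain ⟨y, hyb, hty⟩ := exists_compl_adj_ne h4 hH htb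
  by_cases hya : y = a
  · exact hya ▸ hty
  have hyu : y ≠ u := by
    rintro rfl
    rcases hu t hty.symm with h | h
    · exact htv h
    · exact htb.ne h
  refine absurd (eq_of_dominated_of_card_le_riNumber hH (p₁ := v) (p₂ := y) (q₁ := b) (q₂ := b)
    hbv.symm hbv.symm hyb hyb ?_ (Gᶜ.loopless.irrefl b) huv hub hty htb) htu.symm
  intro h
  rcases hv y h with h | h <;> contradiction

theorem false_of_compl_neighbors_subset (h4 : 4 ≤ riNumber G 2)
    (hH : Fintype.card V ≤ riNumber Gᶜ 2 + 1) (hn : 6 ≤ Fintype.card V) {u v a b : V}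
    (huv : u ≠ v) (hau : a ≠ u) (hbv : b ≠ v) (hab : a ≠ b)
    (hu : ∀ t, Gᶜ.Adj u t → t = v ∨ t = b) (hv : ∀ t, Gᶜ.Adj v t → t = u ∨ t = a ∨ t = b)
    (hva : Gᶜ.Adj v a) : False := by
  by_cases hiso : ∀ t, ¬ Gᶜ.Adj u t
  · have := riNumber_two_le_three_of_compl huv hau.symm (.inr hva) fun t htv hta htu =>
      ⟨fun h => hiso t h.symm, not_and_or.1 fun ⟨h1, h2⟩ => by
        obtain ⟨s, hsa, hst, hsv⟩ := exists_compl_adj_of_triangle h4 hH h2.symm hva.symm h1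
        rcases hv s hsv.symm with rfl | rfl | rfl
        · exact hiso _ hsv
        · exact hsa rfl
        · rcases hv t h1.symm with rfl | rfl | rfl <;> contradiction⟩
    omega
  push Not at hiso
  obtain ⟨s, hs⟩ := hiso
  obtain ⟨s', hs's, hs'⟩ := exists_compl_adj_ne h4 hH hs
  obtain ⟨huv', hub⟩ : Gᶜ.Adj u v ∧ Gᶜ.Adj u b := by
    rcases hu s hs with rfl | rfl <;> rcases hu s' hs' with rfl | rfl <;>
      first | exact absurd rfl hs's | exact ⟨hs, hs'⟩ | exact ⟨hs', hs⟩
  have hnvb : ¬ Gᶜ.Adj v b := by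
    intro h
    obtain ⟨t, htv, htb, htu⟩ := exists_compl_adj_of_triangle h4 hH h huv'.symm hub.symm
    rcases hu t htu.symm with h | h <;> contradiction
  replace hv : ∀ t, Gᶜ.Adj v t → t = u ∨ t = a := by
    intro t ht
    rcases hv t ht with h | h | rfl
    · exact .inl h
    · exact .inr h
    · exact absurd ht hnvb
  have hbu : b ≠ u := hub.ne'
  have hav : a ≠ v := hva.ne'
  have hboth : ∀ t, t ≠ u → t ≠ v → t ≠ a → t ≠ b → Gᶜ.Adj t a ∧ Gᶜ.Adj t b := by
    intro t htu htv hta htb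
    by_cases hb : Gᶜ.Adj t b
    · exact ⟨compl_adj_of_path h4 hH hu hv huv' hub hbv htu htv hb, hb⟩
    by_cases ha : Gᶜ.Adj t a
    · exact ⟨ha, compl_adj_of_path h4 hH hv hu huv'.symm hva hau htv htu ha⟩
    exfalso
    have htu' : ¬ Gᶜ.Adj t u := fun h => by rcases hu t h.symm with h | h <;> contradiction
    have htv' : ¬ Gᶜ.Adj t v := fun h => by rcases hv t h.symm with h | h <;> contradiction
    obtain ⟨p, hp⟩ : ∃ p, Gᶜ.Adj t p := by
      by_contra! hno
      have := riNumber_two_le_three_of_compl htu htv (.inr huv') fun s hsu hsv hst =>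
        ⟨fun h => hno s h.symm, not_and_or.1 fun ⟨h1, h2⟩ => by
          rcases hu s h1.symm with rfl | rfl
          · exact hsv rfl
          · exact hnvb h2.symm⟩
      omega
    obtain ⟨q, hqp, hq⟩ := exists_compl_adj_ne h4 hH hp
    have key : ∀ p q, q ≠ p → Gᶜ.Adj t p → Gᶜ.Adj t q → ¬ Gᶜ.Adj b q → False := by
      intro p q hqp hp hq hbq
      refine htu (eq_of_dominated_of_card_le_riNumber hH (p₁ := v) (p₂ := p) (q₁ := b) (q₂ := q)
        hbv.symm ?_ ?_ hqp.symm ?_ hbq huv' hub hp hq).symm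
      · rintro rfl; exact htv' hq
      · rintro rfl; exact hb hp
      · intro h
        rcases hv p h with rfl | rfl
        · exact htu' hp
        · exact ha hp
    by_cases hbq : Gᶜ.Adj b q
    · by_cases hbp : Gᶜ.Adj b p
      · exact htb (eq_of_compl_common_neighbors hH hqp hq hp hbq hbp)
      · exact key q p hqp.symm hq hp hbp
    · exact key p q hqp hp hq hbq
  obtain ⟨c, hc⟩ : ∃ c, c ∉ ({u, v, a, b} : Finset V) := by
    by_contra! hall
    have := Finset.card_le_card (fun t _ => hall t : Finset.univ ⊆ _)
    have := Finset.card_le_four (a := u) (b := v) (c := a) (d := b)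
    rw [← Finset.card_univ] at hn
    omega
  obtain ⟨d, hd⟩ : ∃ d, d ∉ ({c, u, v, a, b} : Finset V) := by
    by_contra! hall
    have := Finset.card_le_card (fun t _ => hall t : Finset.univ ⊆ _)
    have := Finset.card_le_five (a := c) (b := u) (c := v) (d := a) (e := b)
    rw [← Finset.card_univ] at hn
    omega
  simp only [Finset.mem_insert, Finset.mem_singleton, not_or] at hc hd
  obtain ⟨hcu, hcv, hca, hcb⟩ := hc
  obtain ⟨hdc, hdu, hdv, hda, hdb⟩ := hd
  obtain ⟨h1, h2⟩ := hboth c hcu hcv hca hcb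
  obtain ⟨h3, h4⟩ := hboth d hdu hdv hda hdb
  exact hdc (eq_of_compl_common_neighbors hH hab h3 h4 h1 h2)

end NoSmallPair

theorem stmt_6 {V : Type*} [Fintype V] (G : SimpleGraph V) (n : ℕ)
    (hcard : Fintype.card V = n)
    (h4 : 4 ≤ riNumber G 2)
    (hsum : riNumber G 2 + riNumber Gᶜ 2 = n + 3)
    (f : V → ℕ) (hf : IsKRiDF G 2 f) (hmin : riWeight f = riNumber G 2) :
    ∀ u v : V, f u = 0 → f v = 0 → u ≠ v →
      3 ≤ ((Gᶜ.neighborFinset u ∪ Gᶜ.neighborFinset v) \ {u, v}).card := by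
  intro u v hfu hfv huv
  by_contra! hlt
  have hle := riNumber_two_le_of_compl_neighbors G huv
  have hH : Fintype.card V ≤ riNumber Gᶜ 2 + 1 := by omega
  have hn : 6 ≤ Fintype.card V := by
    have hw : riWeight f ≤ (({u, v} : Finset V)ᶜ).card := by
      refine riWeight_le_card fun t ht => ?_
      simp only [Finset.mem_compl, Finset.mem_insert, Finset.mem_singleton]
      rintro (rfl | rfl) <;> contradiction
    have hc := Finset.card_add_card_compl ({u, v} : Finset V)
    rw [Finset.card_pair huv] at hc
    omega
  obtain ⟨a, b, hab, hN⟩ := Finset.card_eq_two.1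
    (show ((Gᶜ.neighborFinset u ∪ Gᶜ.neighborFinset v) \ {u, v}).card = 2 by omega)
  have hmem : ∀ t, ((Gᶜ.Adj u t ∨ Gᶜ.Adj v t) ∧ t ≠ u ∧ t ≠ v) ↔ t = a ∨ t = b := by
    intro t
    have := Finset.ext_iff.1 hN t
    simpa only [Finset.mem_sdiff, Finset.mem_union, SimpleGraph.mem_neighborFinset,
      Finset.mem_insert, Finset.mem_singleton, not_or] using this
  obtain ⟨ha, hau, hav⟩ := (hmem a).2 (.inl rfl)
  obtain ⟨hb, hbu, hbv⟩ := (hmem b).2 (.inr rfl)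
  have hu : ∀ t, Gᶜ.Adj u t → t = v ∨ t = a ∨ t = b := fun t ht =>
    or_iff_not_imp_left.2 fun h => (hmem t).1 ⟨.inl ht, ht.ne', h⟩
  have hv : ∀ t, Gᶜ.Adj v t → t = u ∨ t = a ∨ t = b := fun t ht =>
    or_iff_not_imp_left.2 fun h => (hmem t).1 ⟨.inr ht, h, ht.ne'⟩
  by_cases hua : Gᶜ.Adj u a
  · by_cases hub : Gᶜ.Adj u b
    · by_cases hva : Gᶜ.Adj v a
      · by_cases hvb : Gᶜ.Adj v b
        · exact huv (eq_of_compl_common_neighbors hH hab hua hub hva hvb)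
        · exact false_of_compl_neighbors_subset h4 hH hn huv.symm hbv hau hab.symm
            (by grind) (by grind) hub
      · exact false_of_compl_neighbors_subset h4 hH hn huv.symm hav hbu hab
          (by grind) (by grind) hua
    · exact false_of_compl_neighbors_subset h4 hH hn huv hbu hav hab.symm
        (by grind) (by grind) (hb.resolve_left hub)
  · exact false_of_compl_neighbors_subset h4 hH hn huv hau hbv hab
      (by grind) (by grind) (ha.resolve_left hua)
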